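/- Let a₁, a₂, b₁, b₂ ∈ ℝ³ be unit vectors with angles α ∈ (0, π) between a₁, a₂ and β ∈ (0, π) between b₁, b₂, and set A_i := a_i·σ, B_j := b_j·σ. If the real numbers γ₁₁, γ₂₁, γ₁₂, γ₂₂ satisfy √(γᵀ F_{α,β} γ) + √(γᵀ F_{α,−β} γ) ≤ 2 with γ := (γ₁₁, γ₂₁, γ₁₂, γ₂₂)ᵀ, then there exists a density matrix ρ on ℂ²⊗ℂ² with Tr[ρ (A_i ⊗ B_j)] = γ_{ij} for all i, j ∈ {1,2} and additionally Tr[ρ (A_i ⊗ I₂)] = 0 and Tr[ρ (I₂ ⊗ B_j)] = 0 for all i, j ∈ {1,2}. -/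

import Mathlib

open Matrix Kronecker Real ComplexOrder

noncomputable section

def σ1 : Matrix (Fin 2) (Fin 2) ℂ := !![0, 1; 1, 0]
def σ2 : Matrix (Fin 2) (Fin 2) ℂ := !![0, -Complex.I; Complex.I, 0]
def σ3 : Matrix (Fin 2) (Fin 2) ℂ := !![1, 0; 0, -1]

/-- For `a ∈ ℝ³`, `a·σ := a₁σ₁ + a₂σ₂ + a₃σ₃`. -/
def dotSigma (a : Fin 3 → ℝ) : Matrix (Fin 2) (Fin 2) ℂ :=
  (a 0 : ℂ) • σ1 + (a 1 : ℂ) • σ2 + (a 2 : ℂ) • σ3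

/-- Euclidean dot product on `ℝ³`. -/
def dot3 (a b : Fin 3 → ℝ) : ℝ := a 0 * b 0 + a 1 * b 1 + a 2 * b 2

/-- A density matrix on `ℂ² ⊗ ℂ²`: positive semidefinite with trace 1. -/
def IsDensityMatrix (ρ : Matrix (Fin 2 × Fin 2) (Fin 2 × Fin 2) ℂ) : Prop :=
  ρ.PosSemidef ∧ ρ.trace = 1

/-- The matrix `F_{α,β}`. -/
def Fmat (α β : ℝ) : Matrix (Fin 4) (Fin 4) ℝ :=
  (1 / (Real.sin α ^ 2 * Real.sin β ^ 2)) •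
    !![1, -Real.cos α, -Real.cos β, Real.cos (α + β);
       -Real.cos α, 1, Real.cos (α - β), -Real.cos β;
       -Real.cos β, Real.cos (α - β), 1, -Real.cos α;
       Real.cos (α + β), -Real.cos β, -Real.cos α, 1]

/-- The quadratic form `γᵀ F_{α,β} γ`. -/
def quadForm (α β : ℝ) (γ : Fin 4 → ℝ) : ℝ := γ ⬝ᵥ (Fmat α β *ᵥ γ)

lemma dotSigma_eq (a : Fin 3 → ℝ) : dotSigma a =
    !![(a 2 : ℂ), a 0 - Complex.I * a 1; a 0 + Complex.I * a 1, -(a 2 : ℂ)] := by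
  ext i j
  fin_cases i <;> fin_cases j <;> simp [dotSigma, σ1, σ2, σ3] <;> ring

lemma dotSigma_herm (a : Fin 3 → ℝ) : (dotSigma a)ᴴ = dotSigma a := by
  rw [dotSigma_eq]
  ext i j
  fin_cases i <;> fin_cases j <;> simp [Matrix.conjTranspose_apply] <;> ring

lemma dotSigma_sq (a : Fin 3 → ℝ) (h : dot3 a a = 1) : dotSigma a * dotSigma a = 1 := by
  have h' : (a 0 : ℂ) * a 0 + a 1 * a 1 + a 2 * a 2 = 1 := by
    unfold dot3 at h; exact_mod_cast h
  rw [dotSigma_eq]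
  ext i j
  fin_cases i <;> fin_cases j <;> simp [Matrix.mul_apply, Fin.sum_univ_two]
  · linear_combination h' - (a 1 : ℂ) ^ 2 * Complex.I_sq
  · ring
  · ring
  · linear_combination h' - (a 1 : ℂ) ^ 2 * Complex.I_sq

lemma dotSigma_anti (a b : Fin 3 → ℝ) (h : dot3 a b = 0) :
    dotSigma b * dotSigma a = -(dotSigma a * dotSigma b) := by
  have h' : (a 0 : ℂ) * b 0 + a 1 * b 1 + a 2 * b 2 = 0 := by
    unfold dot3 at h; exact_mod_cast h
  simp only [dotSigma_eq]
  ext i j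
  fin_cases i <;> fin_cases j <;> simp [Matrix.mul_apply, Fin.sum_univ_two]
  · linear_combination 2 * h' - 2 * (a 1 * b 1 : ℂ) * Complex.I_sq
  · ring
  · ring
  · linear_combination 2 * h' - 2 * (a 1 * b 1 : ℂ) * Complex.I_sq

lemma trace_one_dot (a : Fin 3 → ℝ) : (dotSigma a).trace = 0 := by
  rw [dotSigma_eq]; simp [Matrix.trace, Fin.sum_univ_two]

lemma trace_two_dot (a b : Fin 3 → ℝ) :
    (dotSigma a * dotSigma b).trace = 2 * (dot3 a b : ℂ) := by
  simp only [dotSigma_eq, dot3]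
  simp [Matrix.trace, Matrix.mul_apply, Fin.sum_univ_two]
  linear_combination -2 * (a 1 * b 1 : ℂ) * Complex.I_sq

/-- The determinant of three vectors. -/
def det3 (a b x : Fin 3 → ℝ) : ℝ :=
  (a 1 * b 2 - a 2 * b 1) * x 0 + (a 2 * b 0 - a 0 * b 2) * x 1 + (a 0 * b 1 - a 1 * b 0) * x 2

lemma trace_three_dot (a b x : Fin 3 → ℝ) :
    (dotSigma a * dotSigma b * dotSigma x).trace = 2 * Complex.I * (det3 a b x : ℂ) := by
  simp only [dotSigma_eq, det3]
  simp [Matrix.trace, Matrix.mul_apply, Fin.sum_univ_two]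
  ring

lemma state_exists (e₁ e₂ g₁ g₂ : Fin 3 → ℝ)
    (he₁ : dot3 e₁ e₁ = 1) (he₂ : dot3 e₂ e₂ = 1) (he : dot3 e₁ e₂ = 0)
    (hg₁ : dot3 g₁ g₁ = 1) (hg₂ : dot3 g₂ g₂ = 1) (hg : dot3 g₁ g₂ = 0) :
    ∃ ρ : Matrix (Fin 2 × Fin 2) (Fin 2 × Fin 2) ℂ, IsDensityMatrix ρ ∧
      (∀ x y, det3 e₁ e₂ x = 0 → (ρ * (dotSigma x ⊗ₖ dotSigma y)).trace =
        ((dot3 e₁ x * dot3 g₁ y + dot3 e₂ x * dot3 g₂ y : ℝ) : ℂ)) ∧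
      (∀ x, (ρ * (dotSigma x ⊗ₖ (1 : Matrix (Fin 2) (Fin 2) ℂ))).trace = 0) ∧
      (∀ y, (ρ * ((1 : Matrix (Fin 2) (Fin 2) ℂ) ⊗ₖ dotSigma y)).trace = 0) := by
  set A := dotSigma e₁ ⊗ₖ dotSigma g₁ with hA
  set B := dotSigma e₂ ⊗ₖ dotSigma g₂ with hB
  have hAA : A * A = 1 := by
    rw [hA, ← mul_kronecker_mul, dotSigma_sq _ he₁, dotSigma_sq _ hg₁, one_kronecker_one]
  have hBB : B * B = 1 := by
    rw [hB, ← mul_kronecker_mul, dotSigma_sq _ he₂, dotSigma_sq _ hg₂, one_kronecker_one]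
  have hAB' : A * B = (dotSigma e₁ * dotSigma e₂) ⊗ₖ (dotSigma g₁ * dotSigma g₂) := by
    rw [hA, hB, ← mul_kronecker_mul]
  have hBA : B * A = A * B := by
    rw [hAB', hA, hB, ← mul_kronecker_mul, dotSigma_anti _ _ he, dotSigma_anti _ _ hg]
    ext i j
    simp [kroneckerMap_apply]
  have hAh : Aᴴ = A := by
    rw [hA, conjTranspose_kronecker, dotSigma_herm, dotSigma_herm]
  have hBh : Bᴴ = B := by
    rw [hB, conjTranspose_kronecker, dotSigma_herm, dotSigma_herm]
  set M := 1 + A + B + A * B with hM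
  have hMh : Mᴴ = M := by
    simp only [hM, conjTranspose_add, conjTranspose_mul, hAh, hBh, conjTranspose_one, hBA]
  have hMM : M * M = (4 : ℂ) • M := by
    have h1 : M = (1 + A) * (1 + B) := by rw [hM]; noncomm_ring
    have hc : (1 + B) * (1 + A) = (1 + A) * (1 + B) := by
      simp only [mul_add, add_mul, hBA, mul_one, one_mul]; abel
    have h2 : (1 + A) * (1 + A) = (2 : ℂ) • (1 + A) := by
      rw [two_smul]; simp only [mul_add, add_mul, hAA, mul_one, one_mul]; abel
    have h3 : (1 + B) * (1 + B) = (2 : ℂ) • (1 + B) := by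
      rw [two_smul]; simp only [mul_add, add_mul, hBB, mul_one, one_mul]; abel
    calc M * M = (1 + A) * ((1 + B) * (1 + A)) * (1 + B) := by rw [h1]; simp only [mul_assoc]
      _ = ((1 + A) * (1 + A)) * ((1 + B) * (1 + B)) := by rw [hc]; simp only [mul_assoc]
      _ = (4 : ℂ) • M := by
        rw [h2, h3, h1, smul_mul_smul_comm]; norm_num
  refine ⟨(1 / 4 : ℂ) • M, ⟨?_, ?_⟩, ?_, ?_, ?_⟩
  · have : (1 / 4 : ℂ) • M = ((1 / 4 : ℂ) • M)ᴴ * ((1 / 4 : ℂ) • M) := by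
      rw [conjTranspose_smul, hMh, smul_mul_smul_comm, hMM, smul_smul]
      congr 1
      simp
    rw [this]
    exact posSemidef_conjTranspose_mul_self _
  · rw [trace_smul, hM, hAB', trace_add, trace_add, trace_add, trace_kronecker, trace_kronecker,
      trace_kronecker, trace_one_dot, trace_one_dot, trace_two_dot, he]
    simp [trace_one_dot]
  · intro x y hx
    rw [smul_mul_assoc, trace_smul, hM, hAB', hA, hB]
    simp only [add_mul, one_mul, ← mul_kronecker_mul, trace_add, trace_kronecker, trace_one_dot,
      trace_two_dot, trace_three_dot, hx]
    push_cast
    simp only [smul_eq_mul]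
    ring
  · intro x
    rw [smul_mul_assoc, trace_smul, hM, hAB', hA, hB]
    simp only [add_mul, one_mul, ← mul_kronecker_mul, trace_add, trace_kronecker, trace_one_dot,
      mul_one, trace_two_dot, hg]
    simp
  · intro x
    rw [smul_mul_assoc, trace_smul, hM, hAB', hA, hB]
    simp only [add_mul, one_mul, ← mul_kronecker_mul, trace_add, trace_kronecker, trace_one_dot,
      mul_one, trace_two_dot, he]
    simp

lemma polar_exists (u v : ℝ) : ∃ c s : ℝ, c ^ 2 + s ^ 2 = 1 ∧
    √(u ^ 2 + v ^ 2) * c = u ∧ √(u ^ 2 + v ^ 2) * s = v := by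
  by_cases h : √(u ^ 2 + v ^ 2) = 0
  · have h0 := (Real.sqrt_eq_zero (by positivity)).1 h
    refine ⟨1, 0, by norm_num, ?_, ?_⟩ <;> rw [h] <;> nlinarith [sq_nonneg u, sq_nonneg v]
  · have h2 := Real.sq_sqrt (show 0 ≤ u ^ 2 + v ^ 2 by positivity)
    refine ⟨u / √(u ^ 2 + v ^ 2), v / √(u ^ 2 + v ^ 2), ?_, by field_simp, by field_simp⟩
    rw [div_pow, div_pow, ← add_div, h2, div_self]
    rw [← h2]; positivity

lemma density_comb (R₁ R₂ R₃ : Matrix (Fin 2 × Fin 2) (Fin 2 × Fin 2) ℂ)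
    (h₁ : IsDensityMatrix R₁) (h₂ : IsDensityMatrix R₂) (h₃ : IsDensityMatrix R₃)
    (w₁ w₂ w₃ : ℝ) (hw₁ : 0 ≤ w₁) (hw₂ : 0 ≤ w₂) (hw₃ : 0 ≤ w₃) (hw : w₁ + w₂ + w₃ = 1) :
    IsDensityMatrix ((w₁ : ℂ) • R₁ + (w₂ : ℂ) • R₂ + (w₃ : ℂ) • R₃) := by
  refine ⟨((h₁.1.smul ?_).add (h₂.1.smul ?_)).add (h₃.1.smul ?_), ?_⟩
  · exact_mod_cast hw₁
  · exact_mod_cast hw₂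
  · exact_mod_cast hw₃
  · simp only [trace_add, trace_smul, h₁.2, h₂.2, h₃.2, smul_eq_mul, mul_one]
    exact_mod_cast hw

/-- The linear combination `c • f + s • g` in coordinates. -/
def comb (c s : ℝ) (f g : Fin 3 → ℝ) : Fin 3 → ℝ := fun i => c * f i + s * g i

lemma dot3_comb_left (c s : ℝ) (f g y : Fin 3 → ℝ) :
    dot3 (comb c s f g) y = c * dot3 f y + s * dot3 g y := by
  simp only [dot3, comb]; ring

lemma dot3_comb_right (c s : ℝ) (f g y : Fin 3 → ℝ) :
    dot3 y (comb c s f g) = c * dot3 y f + s * dot3 y g := by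
  simp only [dot3, comb]; ring

lemma dot3_comm' (x y : Fin 3 → ℝ) : dot3 x y = dot3 y x := by
  simp only [dot3]; ring

lemma quad_eq (ca sa cb sb t11 t12 t21 t22 α β : ℝ) (hca : Real.cos α = ca)
    (hsa : Real.sin α = sa) (hcb : Real.cos β = cb) (hsb : Real.sin β = sb)
    (ha : sa ≠ 0) (hb : sb ≠ 0) :
    quadForm α β ![t11, ca * t11 + sa * t21, cb * t11 + sb * t12,
      ca * cb * t11 + ca * sb * t12 + sa * cb * t21 + sa * sb * t22] =
      (t11 - t22) ^ 2 + (t12 + t21) ^ 2 := by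
  have h1 : ca ^ 2 = 1 - sa ^ 2 := by
    rw [← hca, ← hsa]; linear_combination Real.sin_sq_add_cos_sq α
  have h2 : cb ^ 2 = 1 - sb ^ 2 := by
    rw [← hcb, ← hsb]; linear_combination Real.sin_sq_add_cos_sq β
  set g21 := ca * t11 + sa * t21 with hg21
  set g12 := cb * t11 + sb * t12 with hg12
  set g22 := ca * cb * t11 + ca * sb * t12 + sa * cb * t21 + sa * sb * t22 with hg22
  have hX : t11 - ca * g21 - cb * g12 + (ca * cb - sa * sb) * g22 =
      sa * sb * ((ca * cb - sa * sb) * (t22 - t11) - (sa * cb + ca * sb) * (t12 + t21)) := by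
    rw [hg21, hg12, hg22]
    linear_combination (-t11 * (1 - cb ^ 2) + t12 * cb * sb) * h1 +
      (-t11 * sa ^ 2 + t21 * ca * sa) * h2
  have hY : -sa * g21 - sb * g12 + (sa * cb + ca * sb) * g22 =
      sa * sb * ((sa * cb + ca * sb) * (t22 - t11) + (ca * cb - sa * sb) * (t12 + t21)) := by
    rw [hg21, hg12, hg22]
    linear_combination (t11 * sb * cb + t12 * sb ^ 2) * h1 + (t11 * sa * ca + t21 * sa ^ 2) * h2
  have hpr : (ca * cb - sa * sb) ^ 2 + (sa * cb + ca * sb) ^ 2 = 1 := by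
    linear_combination (cb ^ 2 + sb ^ 2) * h1 + h2
  have key : (t11 - ca * g21 - cb * g12 + (ca * cb - sa * sb) * g22) ^ 2 +
      (-sa * g21 - sb * g12 + (sa * cb + ca * sb) * g22) ^ 2 =
      sa ^ 2 * sb ^ 2 * ((t11 - t22) ^ 2 + (t12 + t21) ^ 2) := by
    rw [hX, hY]
    linear_combination (sa ^ 2 * sb ^ 2 * ((t11 - t22) ^ 2 + (t12 + t21) ^ 2)) * hpr
  clear_value g21 g12 g22
  simp only [quadForm, Fmat, Real.cos_add, Real.cos_sub, hca, hsa, hcb, hsb]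
  simp [dotProduct, Matrix.mulVec, Fin.sum_univ_four]
  field_simp
  linear_combination key - (g21 ^ 2 - 2 * cb * g21 * g22) * h1 -
    (g12 ^ 2 - 2 * ca * g12 * g22) * h2 - g22 ^ 2 * hpr

/-- Under the condition `√(γᵀ F_{α,β} γ) + √(γᵀ F_{α,−β} γ) ≤ 2`,
a density matrix reproducing the correlations exists which moreover has vanishing
marginal expectation values. -/
theorem stmt1 (a₁ a₂ b₁ b₂ : Fin 3 → ℝ)
    (ha₁ : dot3 a₁ a₁ = 1) (ha₂ : dot3 a₂ a₂ = 1)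
    (hb₁ : dot3 b₁ b₁ = 1) (hb₂ : dot3 b₂ b₂ = 1)
    (α β : ℝ) (hα : α ∈ Set.Ioo 0 π) (hβ : β ∈ Set.Ioo 0 π)
    (hcα : Real.cos α = dot3 a₁ a₂) (hcβ : Real.cos β = dot3 b₁ b₂)
    (γ11 γ21 γ12 γ22 : ℝ)
    (h : Real.sqrt (quadForm α β ![γ11, γ21, γ12, γ22]) +
        Real.sqrt (quadForm α (-β) ![γ11, γ21, γ12, γ22]) ≤ 2) :
    ∃ ρ : Matrix (Fin 2 × Fin 2) (Fin 2 × Fin 2) ℂ, IsDensityMatrix ρ ∧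
      (ρ * (dotSigma a₁ ⊗ₖ dotSigma b₁)).trace = (γ11 : ℂ) ∧
      (ρ * (dotSigma a₂ ⊗ₖ dotSigma b₁)).trace = (γ21 : ℂ) ∧
      (ρ * (dotSigma a₁ ⊗ₖ dotSigma b₂)).trace = (γ12 : ℂ) ∧
      (ρ * (dotSigma a₂ ⊗ₖ dotSigma b₂)).trace = (γ22 : ℂ) ∧
      (ρ * (dotSigma a₁ ⊗ₖ (1 : Matrix (Fin 2) (Fin 2) ℂ))).trace = 0 ∧
      (ρ * (dotSigma a₂ ⊗ₖ (1 : Matrix (Fin 2) (Fin 2) ℂ))).trace = 0 ∧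
      (ρ * ((1 : Matrix (Fin 2) (Fin 2) ℂ) ⊗ₖ dotSigma b₁)).trace = 0 ∧
      (ρ * ((1 : Matrix (Fin 2) (Fin 2) ℂ) ⊗ₖ dotSigma b₂)).trace = 0 := by
  have hsα : Real.sin α ≠ 0 := (Real.sin_pos_of_pos_of_lt_pi hα.1 hα.2).ne'
  have hsβ : Real.sin β ≠ 0 := (Real.sin_pos_of_pos_of_lt_pi hβ.1 hβ.2).ne'
  have h1 := Real.sin_sq_add_cos_sq α
  have h2 := Real.sin_sq_add_cos_sq β
  set ca := Real.cos α with hca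
  set sa := Real.sin α with hsa
  set cb := Real.cos β with hcb
  set sb := Real.sin β with hsb
  -- orthonormal bases
  set e := comb (1 / sa) (-ca / sa) a₂ a₁ with he
  set f := comb (1 / sb) (-cb / sb) b₂ b₁ with hf
  have hcα' : dot3 a₂ a₁ = ca := by rw [dot3_comm', hcα]
  have hcβ' : dot3 b₂ b₁ = cb := by rw [dot3_comm', hcβ]
  have e11 : dot3 a₁ e = 0 := by
    rw [he, dot3_comb_right, ha₁, ← hcα]; ring
  have f11 : dot3 b₁ f = 0 := by
    rw [hf, dot3_comb_right, hb₁, ← hcβ]; ring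
  have e11' : dot3 e a₁ = 0 := by rw [dot3_comm', e11]
  have f11' : dot3 f b₁ = 0 := by rw [dot3_comm', f11]
  have e2 : dot3 e a₂ = sa := by
    rw [he, dot3_comb_left, ha₂, ← hcα]; field_simp; linear_combination -h1
  have f2 : dot3 f b₂ = sb := by
    rw [hf, dot3_comb_left, hb₂, ← hcβ]; field_simp; linear_combination -h2
  have ee : dot3 e e = 1 := by
    nth_rw 2 [he]
    rw [dot3_comb_right, e2, e11']; field_simp; ring
  have ff : dot3 f f = 1 := by
    nth_rw 2 [hf]
    rw [dot3_comb_right, f2, f11']; field_simp; ring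
  have d1 : det3 a₁ e a₁ = 0 := by simp only [det3]; ring
  have d2 : det3 a₁ e a₂ = 0 := by simp only [det3, he, comb]; ring
  -- the correlation matrix in the orthonormal bases
  obtain ⟨t21, ht21⟩ : ∃ t, γ21 = ca * γ11 + sa * t :=
    ⟨(γ21 - ca * γ11) / sa, by field_simp; ring⟩
  obtain ⟨t12, ht12⟩ : ∃ t, γ12 = cb * γ11 + sb * t :=
    ⟨(γ12 - cb * γ11) / sb, by field_simp; ring⟩
  obtain ⟨t22, ht22⟩ : ∃ t, γ22 = ca * cb * γ11 + ca * sb * t12 + sa * cb * t21 + sa * sb * t :=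
    ⟨(γ22 - (ca * cb * γ11 + ca * sb * t12 + sa * cb * t21)) / (sa * sb), by field_simp; ring⟩
  have q1 := quad_eq ca sa cb sb γ11 t12 t21 t22 α β rfl rfl rfl rfl hsα hsβ
  have q2 := quad_eq ca sa cb (-sb) γ11 (-t12) t21 (-t22) α (-β) rfl rfl (Real.cos_neg β)
    (Real.sin_neg β) hsα (neg_ne_zero.2 hsβ)
  rw [← ht21, show cb * γ11 + -sb * -t12 = γ12 by rw [ht12]; ring,
    show ca * cb * γ11 + ca * -sb * -t12 + sa * cb * t21 + sa * -sb * -t22 = γ22 by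
      rw [ht22]; ring] at q2
  rw [← ht21, ← ht12, ← ht22] at q1
  rw [q1, q2] at h
  obtain ⟨c, s, hcs, hc, hs⟩ := polar_exists (γ11 - t22) (t12 + t21)
  obtain ⟨c', s', hcs', hc', hs'⟩ := polar_exists (γ11 - -t22) (-t12 + t21)
  set p := √((γ11 - t22) ^ 2 + (t12 + t21) ^ 2) with hp
  set q := √((γ11 - -t22) ^ 2 + (-t12 + t21) ^ 2) with hq
  have hp0 : 0 ≤ p := Real.sqrt_nonneg _
  have hq0 : 0 ≤ q := Real.sqrt_nonneg _
  obtain ⟨R₁, hR₁, k₁, l₁, m₁⟩ := state_exists a₁ e (comb c s b₁ f) (comb s (-c) b₁ f) ha₁ ee e11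
    (by simp only [dot3_comb_left, dot3_comb_right, hb₁, ff, f11, f11']; linear_combination hcs)
    (by simp only [dot3_comb_left, dot3_comb_right, hb₁, ff, f11, f11']; linear_combination hcs)
    (by simp only [dot3_comb_left, dot3_comb_right, hb₁, ff, f11, f11']; ring)
  obtain ⟨R₂, hR₂, k₂, l₂, m₂⟩ := state_exists a₁ e (comb (-c) (-s) b₁ f) (comb (-s) c b₁ f)
    ha₁ ee e11
    (by simp only [dot3_comb_left, dot3_comb_right, hb₁, ff, f11, f11']; linear_combination hcs)
    (by simp only [dot3_comb_left, dot3_comb_right, hb₁, ff, f11, f11']; linear_combination hcs)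
    (by simp only [dot3_comb_left, dot3_comb_right, hb₁, ff, f11, f11']; ring)
  obtain ⟨R₃, hR₃, k₃, l₃, m₃⟩ := state_exists a₁ e (comb c' (-s') b₁ f) (comb s' c' b₁ f)
    ha₁ ee e11
    (by simp only [dot3_comb_left, dot3_comb_right, hb₁, ff, f11, f11']; linear_combination hcs')
    (by simp only [dot3_comb_left, dot3_comb_right, hb₁, ff, f11, f11']; linear_combination hcs')
    (by simp only [dot3_comb_left, dot3_comb_right, hb₁, ff, f11, f11']; ring)
  have hr : 0 ≤ (1 - p / 2 - q / 2) / 2 := by linarith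
  refine ⟨((p / 2 + (1 - p / 2 - q / 2) / 2 : ℝ) : ℂ) • R₁ +
    (((1 - p / 2 - q / 2) / 2 : ℝ) : ℂ) • R₂ + ((q / 2 : ℝ) : ℂ) • R₃,
    density_comb _ _ _ hR₁ hR₂ hR₃ _ _ _ (by positivity) hr (by positivity) (by ring),
    ?_, ?_, ?_, ?_, ?_, ?_, ?_, ?_⟩
  · simp only [add_mul, smul_mul_assoc, trace_add, trace_smul, k₁ _ _ d1, k₂ _ _ d1, k₃ _ _ d1,
      smul_eq_mul, dot3_comb_left, ha₁, hb₁, e11', f11']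
    norm_cast
    linear_combination (1 / 2) * hc + (1 / 2) * hc'
  · simp only [add_mul, smul_mul_assoc, trace_add, trace_smul, k₁ _ _ d2, k₂ _ _ d2, k₃ _ _ d2,
      smul_eq_mul, dot3_comb_left, ← hcα, hb₁, e2, f11']
    norm_cast
    rw [ht21]
    linear_combination (ca / 2) * hc + (ca / 2) * hc' + (sa / 2) * hs + (sa / 2) * hs'
  · simp only [add_mul, smul_mul_assoc, trace_add, trace_smul, k₁ _ _ d1, k₂ _ _ d1, k₃ _ _ d1,
      smul_eq_mul, dot3_comb_left, ha₁, ← hcβ, e11', f2]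
    norm_cast
    rw [ht12]
    linear_combination (cb / 2) * hc + (cb / 2) * hc' + (sb / 2) * hs - (sb / 2) * hs'
  · simp only [add_mul, smul_mul_assoc, trace_add, trace_smul, k₁ _ _ d2, k₂ _ _ d2, k₃ _ _ d2,
      smul_eq_mul, dot3_comb_left, ← hcα, ← hcβ, e2, f2]
    norm_cast
    rw [ht22]
    linear_combination (ca * cb / 2) * (hc + hc') + (ca * sb / 2) * (hs - hs') +
      (sa * cb / 2) * (hs + hs') + (sa * sb / 2) * (hc' - hc)
  · simp only [add_mul, smul_mul_assoc, trace_add, trace_smul, l₁, l₂, l₃]; simp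
  · simp only [add_mul, smul_mul_assoc, trace_add, trace_smul, l₁, l₂, l₃]; simp
  · simp only [add_mul, smul_mul_assoc, trace_add, trace_smul, m₁, m₂, m₃]; simp
  · simp only [add_mul, smul_mul_assoc, trace_add, trace_smul, m₁, m₂, m₃]; simp
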